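/- arXiv:math/0110042 — 3 statements merged into one kernel-verified Lean document; each statement's English description precedes it below -/
import Mathlib

section
/- The abelianization of the cyclically presented group G₄(x₄²x₃x₂²x₁⁻¹) (indices mod 4) is isomorphic to ℤ_8 × ℤ_8. -/
namespace Stmt13

/-- The shift automorphism `θ_n` of the free group on generators indexed by `ZMod n`,
determined by `x_i ↦ x_{i+1}`. -/
def theta (n : ℕ) : Monoid.End (FreeGroup (ZMod n)) :=
  FreeGroup.lift (fun i => FreeGroup.of (i + 1))

/-- The set of relators `{w, θ_n(w), …, θ_n^{n-1}(w)}` of the cyclic presentation `G_n(w)`. -/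
def cyclicRels (n : ℕ) (w : FreeGroup (ZMod n)) : Set (FreeGroup (ZMod n)) :=
  { r | ∃ j : ℕ, j < n ∧ r = (theta n ^ j) w }

/-- The cyclically presented group `G_n(w)`. -/
abbrev G (n : ℕ) (w : FreeGroup (ZMod n)) : Type :=
  PresentedGroup (cyclicRels n w)

/-- The generator `x_i` of the free group on `ZMod 4`. -/
def x (i : ZMod 4) : FreeGroup (ZMod 4) := FreeGroup.of i

/-- The relator word. -/
def wd : FreeGroup (ZMod 4) := x 4 ^ 2 * x 3 * x 2 ^ 2 * (x 1)⁻¹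

lemma theta_x (i : ZMod 4) : theta 4 (x i) = x (i + 1) := by
  exact FreeGroup.lift_apply_of

/-- Shifted relators. -/
lemma theta_wd (j : ℕ) : (theta 4 ^ j) wd =
    x (4 + j) ^ 2 * x (3 + j) * x (2 + j) ^ 2 * (x (1 + j))⁻¹ := by
  induction j with
  | zero => simp [wd]
  | succ k ih =>
    rw [pow_succ']
    change theta 4 ((theta 4 ^ k) wd) = _
    rw [ih]
    simp only [map_mul, map_pow, map_inv, theta_x]
    push_cast
    simp only [add_assoc]

/-- Images of generators. -/
def img : ZMod 4 → ZMod 8 × ZMod 8 := ![(1, 4), (4, 1), (1, 0), (0, 1)]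

lemma img_rel : ∀ j : ZMod 4,
    2 • img (4 + j) + img (3 + j) + 2 • img (2 + j) - img (1 + j) = 0 := by
  decide

/-- The forward map on the presented group. -/
def fwd : G 4 wd →* Multiplicative (ZMod 8 × ZMod 8) :=
  PresentedGroup.toGroup (f := fun i => Multiplicative.ofAdd (img i)) (by
    rintro r ⟨j, -, rfl⟩
    rw [theta_wd]
    simp only [map_mul, map_pow, map_inv, x, FreeGroup.lift_apply_of]
    have h := img_rel j
    rw [sub_eq_add_neg] at h
    exact congrArg Multiplicative.ofAdd h)

/-- Generators of the abelianization, additively. -/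
def y (i : ZMod 4) : Additive (Abelianization (G 4 wd)) :=
  Additive.ofMul (Abelianization.of (PresentedGroup.of i))

lemma y_rel (j : ℕ) (hj : j < 4) :
    2 • y (4 + j) + y (3 + j) + 2 • y (2 + j) - y (1 + j) = 0 := by
  have h : PresentedGroup.mk (cyclicRels 4 wd) ((theta 4 ^ j) wd) = 1 :=
    PresentedGroup.one_of_mem ⟨j, hj, rfl⟩
  rw [theta_wd] at h
  have h2 := congrArg (fun t => Additive.ofMul (Abelianization.of t)) h
  simp only [map_mul, map_pow, map_inv] at h2
  rw [sub_eq_add_neg]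
  exact h2

lemma y_rels : (2 • y 0 + y 3 + 2 • y 2 - y 1 = 0) ∧ (2 • y 1 + y 0 + 2 • y 3 - y 2 = 0) ∧
    (2 • y 2 + y 1 + 2 • y 0 - y 3 = 0) ∧ (2 • y 3 + y 2 + 2 • y 1 - y 0 = 0) :=
  ⟨y_rel 0 (by decide), y_rel 1 (by decide), y_rel 2 (by decide), y_rel 3 (by decide)⟩

lemma y_one : y 1 = 4 • y 2 + y 3 := by
  obtain ⟨h0, h1, h2, h3⟩ := y_rels
  linear_combination (norm := module) (-1 : ℤ) • h0 + h1 - h3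

lemma y_zero : y 0 = y 2 + 4 • y 3 := by
  obtain ⟨h0, h1, h2, h3⟩ := y_rels
  linear_combination (norm := module) (-1 : ℤ) • h3 - h0 + h2

lemma y_two8 : (8 : ℤ) • y 2 = 0 := by
  obtain ⟨h0, h1, h2, h3⟩ := y_rels
  linear_combination (norm := module) h0 + h2 - (2 : ℤ) • h1 + (2 : ℤ) • h3

lemma y_three8 : (8 : ℤ) • y 3 = 0 := by
  obtain ⟨h0, h1, h2, h3⟩ := y_rels
  linear_combination (norm := module) h1 + h3 + (2 : ℤ) • h0 - (2 : ℤ) • h2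

/-- The backward map, additively. -/
def bwd : ZMod 8 × ZMod 8 →+ Additive (Abelianization (G 4 wd)) :=
  AddMonoidHom.coprod
    (ZMod.lift 8 ⟨zmultiplesHom _ (y 2), by simpa using y_two8⟩)
    (ZMod.lift 8 ⟨zmultiplesHom _ (y 3), by simpa using y_three8⟩)

lemma bwd_apply (m n : ℤ) : bwd ((m : ZMod 8), (n : ZMod 8)) = m • y 2 + n • y 3 := by
  simp [bwd]

lemma bwd_img (i : ZMod 4) : bwd (img i) = y i := by
  have e : ∀ i : Fin 4, bwd (img i) = y i := by
    intro i
    fin_cases i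
    · have := bwd_apply 1 4
      exact this.trans (by rw [one_smul]; exact y_zero.symm)
    · have := bwd_apply 4 1
      exact this.trans (by rw [one_smul]; exact y_one.symm)
    · have := bwd_apply 1 0
      exact this.trans (by rw [one_smul, zero_smul, add_zero]; rfl)
    · have := bwd_apply 0 1
      exact this.trans (by rw [one_smul, zero_smul, zero_add]; rfl)
  exact e i

lemma fwd_y (i : ZMod 4) : Abelianization.lift fwd (y i).toMul = Multiplicative.ofAdd (img i) := by
  simp [y, fwd]

lemma fwd_bwd (p : ZMod 8 × ZMod 8) :
    MonoidHom.toAdditiveLeft (Abelianization.lift fwd) (bwd p) = p := by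
  obtain ⟨a, b⟩ := p
  obtain ⟨m, rfl⟩ := ZMod.intCast_surjective a
  obtain ⟨n, rfl⟩ := ZMod.intCast_surjective b
  have h2 : MonoidHom.toAdditiveLeft (Abelianization.lift fwd) (y 2) = (1, 0) := fwd_y 2
  have h3 : MonoidHom.toAdditiveLeft (Abelianization.lift fwd) (y 3) = (0, 1) := fwd_y 3
  rw [bwd_apply, map_add, map_zsmul, map_zsmul, h2, h3]
  simp

/-- The abelianization of `G₄(x₄²x₃x₂²x₁⁻¹)` (the first homology of the corresponding
4-fold strongly-cyclic branched covering) is `ℤ_8 × ℤ_8`. -/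
theorem stmt13 :
    Nonempty (Abelianization (G 4 (x 4 ^ 2 * x 3 * x 2 ^ 2 * (x 1)⁻¹)) ≃*
      Multiplicative (ZMod 8 × ZMod 8)) := by
  change Nonempty (Abelianization (G 4 wd) ≃* Multiplicative (ZMod 8 × ZMod 8))
  refine ⟨MonoidHom.toMulEquiv (Abelianization.lift fwd) (AddMonoidHom.toMultiplicativeLeft bwd)
    ?_ ?_⟩
  · apply Abelianization.hom_ext
    apply PresentedGroup.ext
    intro i
    have h := bwd_img i
    have h2 := fwd_y i
    change bwd (Abelianization.lift fwd (y i).toMul).toAdd = y i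
    rw [h2]
    exact h
  · refine MonoidHom.ext fun p => ?_
    exact fwd_bwd p.toAdd

end Stmt13
end

section
/- The abelianization of the cyclically presented group G₄(x₄x₂x₃x₄x₂x₁⁻¹) (indices mod 4) is isomorphic to ℤ_8 × ℤ_8. -/
namespace Stmt15

/-- The shift automorphism `θ_n` of the free group on generators indexed by `ZMod n`,
determined by `x_i ↦ x_{i+1}`. -/
def theta (n : ℕ) : Monoid.End (FreeGroup (ZMod n)) :=
  FreeGroup.lift (fun i => FreeGroup.of (i + 1))

/-- The set of relators `{w, θ_n(w), …, θ_n^{n-1}(w)}` of the cyclic presentation `G_n(w)`. -/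
def cyclicRels (n : ℕ) (w : FreeGroup (ZMod n)) : Set (FreeGroup (ZMod n)) :=
  { r | ∃ j : ℕ, j < n ∧ r = (theta n ^ j) w }

/-- The cyclically presented group `G_n(w)`. -/
abbrev G (n : ℕ) (w : FreeGroup (ZMod n)) : Type :=
  PresentedGroup (cyclicRels n w)

/-- The generator `x_i` of the free group on `ZMod 4`. -/
def x (i : ZMod 4) : FreeGroup (ZMod 4) := FreeGroup.of i

/-- Images of the generators in `ℤ_8 × ℤ_8`. -/
def img (i : ZMod 4) : ZMod 8 × ZMod 8 :=
  if i = 0 then (4, 1) else if i = 1 then (1, 0) else if i = 2 then (0, 1) else (1, 4)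

abbrev W : FreeGroup (ZMod 4) := x 4 * x 2 * x 3 * x 4 * x 2 * (x 1)⁻¹

lemma theta_x (i : ZMod 4) : theta 4 (x i) = x (i + 1) := by
  exact FreeGroup.lift_apply_of

lemma theta_pow_W (j : ℕ) : (theta 4 ^ j) W =
    x (4 + j) * x (2 + j) * x (3 + j) * x (4 + j) * x (2 + j) * (x (1 + j))⁻¹ := by
  induction j with
  | zero => simp [W]
  | succ k ih =>
    rw [pow_succ']
    change theta 4 ((theta 4 ^ k) W) = _
    rw [ih]
    simp only [map_mul, map_inv, theta_x, Nat.cast_succ, add_assoc]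

def fwdFree : FreeGroup (ZMod 4) →* Multiplicative (ZMod 8 × ZMod 8) :=
  FreeGroup.lift (fun i => Multiplicative.ofAdd (img i))

lemma fwdFree_x (i : ZMod 4) : fwdFree (x i) = Multiplicative.ofAdd (img i) := by
  simp [fwdFree, x]

lemma fwd_rel : ∀ r ∈ cyclicRels 4 W, fwdFree r = 1 := by
  rintro r ⟨j, hj, rfl⟩
  rw [theta_pow_W]
  simp only [map_mul, map_inv, fwdFree_x]
  interval_cases j <;> decide

def fwd : Abelianization (G 4 W) →* Multiplicative (ZMod 8 × ZMod 8) :=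
  Abelianization.lift (PresentedGroup.toGroup (f := fun i => Multiplicative.ofAdd (img i)) fwd_rel)

/-- The images of the generators in the (additive) abelianization. -/
def q : FreeGroup (ZMod 4) →* Abelianization (G 4 W) :=
  Abelianization.of.comp (PresentedGroup.mk (cyclicRels 4 W))

def b (i : ZMod 4) : Additive (Abelianization (G 4 W)) := Additive.ofMul (q (x i))

lemma fwd_b (i : ZMod 4) : fwd (b i).toMul = Multiplicative.ofAdd (img i) := by
  change fwd (Abelianization.of (PresentedGroup.of i)) = _
  rw [fwd, Abelianization.lift_apply_of]
  exact PresentedGroup.toGroup.of _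

lemma b_rel (j : ℕ) (hj : j < 4) :
    b (4 + j) + b (2 + j) + b (3 + j) + b (4 + j) + b (2 + j) - b (1 + j) = 0 := by
  have h : q ((theta 4 ^ j) W) = 1 := by
    have : PresentedGroup.mk (cyclicRels 4 W) ((theta 4 ^ j) W) = 1 :=
      PresentedGroup.one_of_mem ⟨j, hj, rfl⟩
    simp only [q, MonoidHom.comp_apply, this, map_one]
  rw [theta_pow_W] at h
  simp only [map_mul, map_inv] at h
  have := congrArg Additive.ofMul h
  simp only [ofMul_mul, ofMul_inv, ofMul_one, ← sub_eq_add_neg] at this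
  exact this

lemma r0 : b 0 + b 2 + b 3 + b 0 + b 2 - b 1 = 0 := b_rel 0 (by norm_num)
lemma r1 : b 1 + b 3 + b 0 + b 1 + b 3 - b 2 = 0 := b_rel 1 (by norm_num)
lemma r2 : b 2 + b 0 + b 1 + b 2 + b 0 - b 3 = 0 := b_rel 2 (by norm_num)
lemma r3 : b 3 + b 1 + b 2 + b 3 + b 1 - b 0 = 0 := b_rel 3 (by norm_num)

lemma lin {A : Type*} [AddCommGroup A] (a0 a1 a2 a3 : A)
    (h0 : a0 + a2 + a3 + a0 + a2 - a1 = 0) (h1 : a1 + a3 + a0 + a1 + a3 - a2 = 0)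
    (h2 : a2 + a0 + a1 + a2 + a0 - a3 = 0) (h3 : a3 + a1 + a2 + a3 + a1 - a0 = 0) :
    a3 = a1 + (4 : ℤ) • a2 ∧ a0 = (4 : ℤ) • a1 + a2 ∧ (8 : ℤ) • a1 = 0 ∧ (8 : ℤ) • a2 = 0 := by
  refine ⟨?_, ?_, ?_, ?_⟩
  · linear_combination (norm := module) h1 - h3 - h2
  · linear_combination (norm := module) h0 - h2 - h3
  · linear_combination (norm := module) h1 + h3 - (2 : ℤ) • h0 + (2 : ℤ) • h2
  · linear_combination (norm := module) h0 + h2 - (2 : ℤ) • h1 + (2 : ℤ) • h3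

lemma b3 : b 3 = b 1 + (4 : ℤ) • b 2 := (lin _ _ _ _ r0 r1 r2 r3).1
lemma b0 : b 0 = (4 : ℤ) • b 1 + b 2 := (lin _ _ _ _ r0 r1 r2 r3).2.1
lemma b1_ord : (8 : ℤ) • b 1 = 0 := (lin _ _ _ _ r0 r1 r2 r3).2.2.1
lemma b2_ord : (8 : ℤ) • b 2 = 0 := (lin _ _ _ _ r0 r1 r2 r3).2.2.2

def bwd : ZMod 8 × ZMod 8 →+ Additive (Abelianization (G 4 W)) :=
  AddMonoidHom.coprod
    (ZMod.lift 8 ⟨zmultiplesHom _ (b 1), by simpa using b1_ord⟩)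
    (ZMod.lift 8 ⟨zmultiplesHom _ (b 2), by simpa using b2_ord⟩)

lemma bwd_int (m n : ℤ) : bwd ((m : ZMod 8), (n : ZMod 8)) = m • b 1 + n • b 2 := by
  simp only [bwd, AddMonoidHom.coprod_apply, ZMod.lift_coe, zmultiplesHom_apply]

lemma bwd_img (i : ZMod 4) : bwd (img i) = b i := by
  fin_cases i
  · exact (bwd_int 4 1).trans (by rw [one_zsmul]; exact b0.symm)
  · exact (bwd_int 1 0).trans (by rw [one_zsmul, zero_zsmul, add_zero]; rfl)
  · exact (bwd_int 0 1).trans (by rw [one_zsmul, zero_zsmul, zero_add]; rfl)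
  · exact (bwd_int 1 4).trans (by rw [one_zsmul]; exact b3.symm)

def bwdM : Multiplicative (ZMod 8 × ZMod 8) →* Abelianization (G 4 W) :=
  AddMonoidHom.toMultiplicativeLeft bwd

lemma bwd_fwd : bwdM.comp fwd = MonoidHom.id _ := by
  apply Abelianization.hom_ext
  apply PresentedGroup.ext
  intro i
  change bwdM (fwd (b i).toMul) = (b i).toMul
  rw [fwd_b]
  exact congrArg Additive.toMul (bwd_img i)

lemma fwd_bwd : fwd.comp bwdM = MonoidHom.id _ := by
  refine MonoidHom.ext fun p => ?_
  obtain ⟨⟨m, n⟩, rfl⟩ := Multiplicative.ofAdd.surjective p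
  obtain ⟨m, rfl⟩ := ZMod.intCast_surjective m
  obtain ⟨n, rfl⟩ := ZMod.intCast_surjective n
  have h : bwdM (Multiplicative.ofAdd ((m : ZMod 8), (n : ZMod 8)))
      = (b 1).toMul ^ m * (b 2).toMul ^ n := congrArg Additive.toMul (bwd_int m n)
  rw [MonoidHom.comp_apply, h, map_mul, map_zpow, map_zpow, fwd_b, fwd_b, ← ofAdd_zsmul,
    ← ofAdd_zsmul, ← ofAdd_add]
  have e1 : img 1 = (1, 0) := rfl
  have e2 : img 2 = (0, 1) := rfl
  simp [e1, e2]

/-- The abelianization of `G₄(x₄x₂x₃x₄x₂x₁⁻¹)` (the first homology of the corresponding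
4-fold strongly-cyclic branched covering) is `ℤ_8 × ℤ_8`. -/
theorem stmt15 :
    Nonempty (Abelianization (G 4 (x 4 * x 2 * x 3 * x 4 * x 2 * (x 1)⁻¹)) ≃*
      Multiplicative (ZMod 8 × ZMod 8)) := by
  exact ⟨MonoidHom.toMulEquiv fwd bwdM bwd_fwd fwd_bwd⟩

end Stmt15
end

section
/- The abelianization of the cyclically presented group G₄(x₄x₃x₁x₃x₂x₁⁻¹) (indices mod 4) is isomorphic to ℤ × ℤ_4. -/
namespace Stmt16

/-- The shift automorphism `θ_n` of the free group on generators indexed by `ZMod n`,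
determined by `x_i ↦ x_{i+1}`. -/
def theta (n : ℕ) : Monoid.End (FreeGroup (ZMod n)) :=
  FreeGroup.lift (fun i => FreeGroup.of (i + 1))

/-- The set of relators `{w, θ_n(w), …, θ_n^{n-1}(w)}` of the cyclic presentation `G_n(w)`. -/
def cyclicRels (n : ℕ) (w : FreeGroup (ZMod n)) : Set (FreeGroup (ZMod n)) :=
  { r | ∃ j : ℕ, j < n ∧ r = (theta n ^ j) w }

/-- The cyclically presented group `G_n(w)`. -/
abbrev G (n : ℕ) (w : FreeGroup (ZMod n)) : Type :=
  PresentedGroup (cyclicRels n w)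

/-- The generator `x_i` of the free group on `ZMod 4`. -/
def x (i : ZMod 4) : FreeGroup (ZMod 4) := FreeGroup.of i

/-- The word defining the group. -/
abbrev wd : FreeGroup (ZMod 4) := x 4 * x 3 * x 1 * x 3 * x 2 * (x 1)⁻¹

/-- Images of the generators in the target. -/
def img (i : ZMod 4) : Multiplicative (ℤ × ZMod 4) :=
  Multiplicative.ofAdd ((-1 : ℤ) ^ i.val, (-1 : ZMod 4) ^ (i.val + 1) * i)

theorem theta_of (i : ZMod 4) : theta 4 (FreeGroup.of i) = FreeGroup.of (i + 1) := by
  exact FreeGroup.lift_apply_of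

theorem theta_pow_of (j : ℕ) (i : ZMod 4) :
    (theta 4 ^ j) (FreeGroup.of i) = FreeGroup.of (i + j) := by
  induction j generalizing i with
  | zero => simp
  | succ k ih =>
    rw [pow_succ]
    change (theta 4 ^ k) (theta 4 (FreeGroup.of i)) = _
    rw [theta_of, ih]
    congr 1
    push_cast
    ring

theorem theta_pow_wd (j : ℕ) :
    (theta 4 ^ j) wd = x (4 + j) * x (3 + j) * x (1 + j) * x (3 + j) * x (2 + j)
      * (x (1 + j))⁻¹ := by
  simp only [wd, x, map_mul, map_inv, theta_pow_of]

theorem img_rel (i : ZMod 4) :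
    img (4 + i) * img (3 + i) * img (1 + i) * img (3 + i) * img (2 + i) * (img (1 + i))⁻¹ = 1 := by
  revert i
  decide

theorem rels_trivial : ∀ r ∈ cyclicRels 4 wd, FreeGroup.lift img r = 1 := by
  rintro r ⟨j, -, rfl⟩
  rw [theta_pow_wd]
  simpa [x] using img_rel (j : ZMod 4)

/-- The forward homomorphism. -/
def fwd : Abelianization (G 4 wd) →* Multiplicative (ℤ × ZMod 4) :=
  Abelianization.lift (PresentedGroup.toGroup rels_trivial)

/-- Generators of the abelianization, additively. -/
def y (i : ZMod 4) : Additive (Abelianization (G 4 wd)) :=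
  Additive.ofMul (Abelianization.of (PresentedGroup.of i))

theorem fwd_y (i : ZMod 4) : fwd (y i).toMul = img i := by
  simp [fwd, y]

theorem y_rel (j : ℕ) (hj : j < 4) :
    y (4 + j) + y (3 + j) + y (1 + j) + y (3 + j) + y (2 + j) - y (1 + j) = 0 := by
  have h : PresentedGroup.mk (cyclicRels 4 wd) ((theta 4 ^ j) wd) = 1 :=
    PresentedGroup.one_of_mem ⟨j, hj, rfl⟩
  rw [theta_pow_wd] at h
  have h2 := congrArg (fun g => Additive.ofMul (Abelianization.of g)) h
  simp only [map_mul, map_inv, ofMul_mul, ofMul_inv, map_one, ofMul_one] at h2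
  rw [sub_eq_add_neg]
  exact h2

theorem rel0 : y 0 + 2 • y 3 + y 2 = 0 := by
  have h : y 0 + y 3 + y 1 + y 3 + y 2 - y 1 = 0 := y_rel 0 (by norm_num)
  rw [← h]; abel

theorem rel1 : y 1 + 2 • y 0 + y 3 = 0 := by
  have h : y 1 + y 0 + y 2 + y 0 + y 3 - y 2 = 0 := y_rel 1 (by norm_num)
  rw [← h]; abel

theorem rel2 : y 2 + 2 • y 1 + y 0 = 0 := by
  have h : y 2 + y 1 + y 3 + y 1 + y 0 - y 3 = 0 := y_rel 2 (by norm_num)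
  rw [← h]; abel

theorem y2 : y 2 = - (2 • y 1) - y 0 := by
  rw [← sub_eq_zero, ← rel2]; abel

theorem y3 : y 3 = - (2 • y 0) - y 1 := by
  rw [← sub_eq_zero, ← rel1]; abel

theorem four : (4 : ℤ) • (y 0 + y 1) = 0 := by
  have h := rel0
  rw [y2, y3] at h
  rw [← neg_eq_zero, ← h]; abel

/-- The backward homomorphism. -/
def bwd : ℤ × ZMod 4 →+ Additive (Abelianization (G 4 wd)) :=
  AddMonoidHom.coprod (zmultiplesHom _ (y 0))
    (ZMod.lift 4 ⟨zmultiplesHom _ (y 0 + y 1), by simpa using four⟩)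

theorem bwd_apply (a b : ℤ) : bwd (a, (b : ZMod 4)) = a • y 0 + b • (y 0 + y 1) := by
  simp [bwd]

theorem bwd_img (i : ZMod 4) : bwd (img i).toAdd = y i := by
  have h0 : (img 0).toAdd = (1, ((0 : ℤ) : ZMod 4)) := by decide
  have h1 : (img 1).toAdd = (-1, ((1 : ℤ) : ZMod 4)) := by decide
  have h2 : (img 2).toAdd = (1, ((-2 : ℤ) : ZMod 4)) := by decide
  have h3 : (img 3).toAdd = (-1, ((-1 : ℤ) : ZMod 4)) := by decide
  have hi : i = 0 ∨ i = 1 ∨ i = 2 ∨ i = 3 := by revert i; decide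
  rcases hi with rfl | rfl | rfl | rfl
  · rw [h0, bwd_apply]; abel
  · rw [h1, bwd_apply]; abel
  · rw [h2, bwd_apply, y2]; abel
  · rw [h3, bwd_apply, y3]; abel

theorem bwd_fwd (g : Abelianization (G 4 wd)) : (bwd (fwd g).toAdd).toMul = g := by
  have h : (AddMonoidHom.toMultiplicativeLeft bwd).comp fwd = MonoidHom.id _ := by
    ext i
    have := congrArg Additive.toMul (bwd_img i)
    rw [← fwd_y] at this
    exact this
  exact DFunLike.congr_fun h g

theorem fwd_bwd (p : ℤ × ZMod 4) : fwd (bwd p).toMul = Multiplicative.ofAdd p := by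
  obtain ⟨a, b⟩ := p
  obtain ⟨b, rfl⟩ := ZMod.intCast_surjective b
  rw [bwd_apply]
  simp only [toMul_add, toMul_zsmul, map_mul, map_zpow, fwd_y]
  have h0 : img 0 = Multiplicative.ofAdd (1, 0) := by decide
  have h1 : img 1 = Multiplicative.ofAdd (-1, 1) := by decide
  rw [h0, h1, ← ofAdd_add, ← ofAdd_zsmul, ← ofAdd_zsmul, ← ofAdd_add]
  simp

/-- The abelianization of `G₄(x₄x₃x₁x₃x₂x₁⁻¹)` (the first homology of the corresponding
4-fold strongly-cyclic branched covering) is `ℤ × ℤ_4`. -/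
theorem stmt16 :
    Nonempty (Abelianization (G 4 (x 4 * x 3 * x 1 * x 3 * x 2 * (x 1)⁻¹)) ≃*
      Multiplicative (ℤ × ZMod 4)) := by
  exact ⟨{ toFun := fwd
           invFun := fun p => (bwd p.toAdd).toMul
           left_inv := bwd_fwd
           right_inv := fun p => fwd_bwd p.toAdd
           map_mul' := map_mul fwd }⟩

end Stmt16
end
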